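/- For all x > 0 and 0 < a < b, the integral over t in (0, ∞) of t·sin(b t)·cos(a t) / (x² + t²) dt equals (π/2) · e^{-b x} · cosh(a x). -/

import Mathlib

open Real MeasureTheory Filter intervalIntegral

lemma integrable_inv_sq_add_sq {x : ℝ} (hx : 0 < x) :
    Integrable fun t : ℝ => (x ^ 2 + t ^ 2)⁻¹ := by
  have h := (integrable_inv_one_add_sq.comp_mul_left' (inv_ne_zero hx.ne')).const_mul (x ^ 2)⁻¹
  refine h.congr (.of_forall fun t => ?_)
  field_simp

lemma ofReal_add_mul_I_ne_zero {x : ℝ} (hx : 0 < x) (t : ℝ) : (x : ℂ) + t * Complex.I ≠ 0 := by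
  intro h
  have := congrArg Complex.re h
  simp at this
  exact hx.ne' this

lemma integrable_inv_ofReal_add_mul_I_sq {x : ℝ} (hx : 0 < x) :
    Integrable fun t : ℝ => (((x : ℂ) + t * Complex.I) ^ 2)⁻¹ := by
  refine (integrable_inv_sq_add_sq hx).mono' ?_ (.of_forall fun t => ?_)
  · refine Continuous.aestronglyMeasurable ?_
    refine Continuous.inv₀ (by fun_prop) fun t => pow_ne_zero 2 (ofReal_add_mul_I_ne_zero hx t)
  · rw [norm_inv, norm_pow, ← Complex.normSq_eq_norm_sq, Complex.normSq_add_mul_I]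

lemma integrable_max_mul_exp {x : ℝ} (hx : 0 < x) :
    Integrable fun v : ℝ => max v 0 * rexp (-x * v) := by
  have h := integrableOn_rpow_mul_exp_neg_mul_rpow (p := 1) (s := 1) (b := x)
    (by norm_num) one_pos hx
  refine (h.integrable_indicator measurableSet_Ioi).congr (.of_forall fun v => ?_)
  by_cases hv : 0 < v
  · simp [Set.indicator_of_mem (Set.mem_Ioi.2 hv), max_eq_left hv.le]
  · simp [Set.indicator_of_notMem (show v ∉ Set.Ioi 0 by simpa using hv),
      max_eq_right (not_lt.1 hv)]

lemma integral_Ioi_mul_cexp_neg_mul {r : ℂ} (hr : 0 < r.re) :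
    ∫ t in Set.Ioi (0 : ℝ), (t : ℂ) * Complex.exp (-r * t) = (r ^ 2)⁻¹ := by
  have hr0 : r ≠ 0 := fun h => by simp [h] at hr
  have hnorm : ∀ t : ℝ, ‖Complex.exp (-r * t)‖ = rexp (-r.re * t) := fun t => by
    simp [Complex.norm_exp]
  have hderiv : ∀ t ∈ Set.Ici (0 : ℝ), HasDerivAt
      (fun t : ℝ => -(r⁻¹ * ((t : ℂ) * Complex.exp (-r * t)) + (r ^ 2)⁻¹ * Complex.exp (-r * t)))
      ((t : ℂ) * Complex.exp (-r * t)) t := fun t _ => by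
    have h1 : HasDerivAt (fun t : ℝ => (t : ℂ)) 1 t := Complex.ofRealCLM.hasDerivAt
    have h2 := (h1.const_mul (-r)).cexp
    refine (((h1.fun_mul h2).const_mul r⁻¹).fun_add
      (h2.const_mul (r ^ 2)⁻¹)).fun_neg.congr_deriv ?_
    field_simp
    ring
  have hexp : Tendsto (fun t : ℝ => Complex.exp (-r * t)) atTop (nhds 0) := by
    rw [tendsto_zero_iff_norm_tendsto_zero]
    simp only [hnorm]
    exact tendsto_exp_atBot.comp (tendsto_id.const_mul_atTop_of_neg (neg_neg_of_pos hr))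
  have hmul : Tendsto (fun t : ℝ => (t : ℂ) * Complex.exp (-r * t)) atTop (nhds 0) := by
    rw [tendsto_zero_iff_norm_tendsto_zero]
    refine (tendsto_rpow_mul_exp_neg_mul_atTop_nhds_zero 1 r.re hr).congr' ?_
    filter_upwards [eventually_ge_atTop 0] with t ht
    rw [norm_mul, hnorm, Complex.norm_of_nonneg ht, rpow_one]
  have hint : IntegrableOn (fun t : ℝ => (t : ℂ) * Complex.exp (-r * t)) (Set.Ioi 0) := by
    refine (integrable_max_mul_exp hr).integrableOn.mono'
      (Continuous.aestronglyMeasurable (by fun_prop)) ?_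
    filter_upwards [ae_restrict_mem measurableSet_Ioi] with t ht
    rw [norm_mul, hnorm, Complex.norm_of_nonneg (le_of_lt ht), max_eq_left (le_of_lt ht)]
  rw [integral_Ioi_of_hasDerivAt_of_tendsto' hderiv hint
    ((hmul.const_mul r⁻¹).add (hexp.const_mul (r ^ 2)⁻¹)).neg]
  simp

/-- The Fourier transform of `v ↦ max v 0 * exp (-x v)`. -/
lemma fourier_max_mul_exp {x : ℝ} (hx : 0 < x) :
    FourierTransform.fourier (fun v : ℝ => ((max v 0 * rexp (-x * v) : ℝ) : ℂ)) =
      fun w : ℝ => (((x : ℂ) + (2 * π * w : ℝ) * Complex.I) ^ 2)⁻¹ := by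
  ext w
  rw [Real.fourier_real_eq_integral_exp_smul]
  have hr : 0 < ((x : ℂ) + (2 * π * w : ℝ) * Complex.I).re := by simpa using hx
  rw [← integral_Ioi_mul_cexp_neg_mul hr, ← MeasureTheory.integral_indicator measurableSet_Ioi]
  refine integral_congr_ae (.of_forall fun v => ?_)
  by_cases hv : 0 < v
  · rw [Set.indicator_of_mem (Set.mem_Ioi.2 hv)]
    simp only [max_eq_left hv.le, smul_eq_mul]
    push_cast
    rw [mul_left_comm, ← Complex.exp_add]
    congr 2
    ring
  · rw [Set.indicator_of_notMem (by simpa using hv)]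
    simp [max_eq_right (not_lt.1 hv)]

lemma integral_exp_mul_inv_ofReal_add_mul_I_sq {x : ℝ} (hx : 0 < x) (c : ℝ) :
    ∫ t : ℝ, Complex.exp ((t * c : ℝ) * Complex.I) * (((x : ℂ) + t * Complex.I) ^ 2)⁻¹ =
      ((2 * π * (max c 0 * rexp (-x * c)) : ℝ) : ℂ) := by
  have hF : Integrable fun w : ℝ => (((x : ℂ) + (2 * π * w : ℝ) * Complex.I) ^ 2)⁻¹ :=
    (integrable_inv_ofReal_add_mul_I_sq hx).comp_mul_left' two_pi_pos.ne'
  have inv := Continuous.fourierInv_fourier_eq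
    (f := fun v : ℝ => ((max v 0 * rexp (-x * v) : ℝ) : ℂ)) (by fun_prop)
    (integrable_max_mul_exp hx).ofReal (by rwa [fourier_max_mul_exp hx])
  have hc := congrFun inv c
  rw [fourier_max_mul_exp hx, Real.fourierInv_eq'] at hc
  have hs := Measure.integral_comp_mul_left (fun t : ℝ =>
    Complex.exp ((t * c : ℝ) * Complex.I) * (((x : ℂ) + t * Complex.I) ^ 2)⁻¹) (2 * π)
  have he : ∀ v : ℝ, 2 * π * inner ℝ v c = 2 * π * v * c := fun v => by
    simp [mul_assoc, mul_comm]
  simp only [he, smul_eq_mul] at hc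
  rw [hc, abs_of_pos (inv_pos.2 two_pi_pos)] at hs
  rw [Complex.ofReal_mul, hs, Complex.real_smul, ← mul_assoc, ← Complex.ofReal_mul,
    mul_inv_cancel₀ two_pi_pos.ne', Complex.ofReal_one, one_mul]

lemma integrable_cos_mul_sq_sub_sq_div {x : ℝ} (hx : 0 < x) (c : ℝ) :
    Integrable fun t : ℝ => cos (c * t) * ((x ^ 2 - t ^ 2) / (x ^ 2 + t ^ 2) ^ 2) := by
  refine (integrable_inv_sq_add_sq hx).mono' ?_ (.of_forall fun t => ?_)
  · refine Continuous.aestronglyMeasurable ?_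
    have : ∀ t : ℝ, (x ^ 2 + t ^ 2) ^ 2 ≠ 0 := fun t => by positivity
    fun_prop (disch := assumption)
  · have hp : 0 < x ^ 2 + t ^ 2 := by positivity
    rw [norm_mul, norm_div, norm_pow, Real.norm_eq_abs, Real.norm_eq_abs, Real.norm_eq_abs,
      abs_of_pos hp]
    have h1 : |x ^ 2 - t ^ 2| ≤ x ^ 2 + t ^ 2 := by
      rw [abs_le]; constructor <;> nlinarith [sq_nonneg x, sq_nonneg t]
    calc _ ≤ 1 * ((x ^ 2 + t ^ 2) / (x ^ 2 + t ^ 2) ^ 2) := by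
          gcongr
          exact abs_cos_le_one _
      _ = _ := by field_simp

lemma integral_Ioi_cos_mul_sq_sub_sq_div {x c : ℝ} (hx : 0 < x) (hc : 0 < c) :
    ∫ t in Set.Ioi (0 : ℝ), cos (c * t) * ((x ^ 2 - t ^ 2) / (x ^ 2 + t ^ 2) ^ 2) =
      π / 2 * c * rexp (-c * x) := by
  have hint : ∀ d : ℝ, Integrable fun t : ℝ =>
      Complex.exp ((t * d : ℝ) * Complex.I) * (((x : ℂ) + t * Complex.I) ^ 2)⁻¹ := fun d =>
    (integrable_inv_ofReal_add_mul_I_sq hx).bdd_mul (c := 1)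
      (Continuous.aestronglyMeasurable (by fun_prop))
      (.of_forall fun t => (Complex.norm_exp_ofReal_mul_I _).le)
  have hsum := integral_add (hint c) (hint (-c))
  rw [integral_exp_mul_inv_ofReal_add_mul_I_sq hx, integral_exp_mul_inv_ofReal_add_mul_I_sq hx,
    max_eq_left hc.le, max_eq_right (neg_nonpos.2 hc.le)] at hsum
  have hre := congrArg Complex.re hsum
  have h3 := integral_re ((hint c).add (hint (-c)))
  simp only [Pi.add_apply, RCLike.re_eq_complex_re] at h3
  rw [← h3] at hre
  have hpt : ∀ t : ℝ, (Complex.exp ((t * c : ℝ) * Complex.I) * (((x : ℂ) + t * Complex.I) ^ 2)⁻¹ +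
      Complex.exp ((t * -c : ℝ) * Complex.I) * (((x : ℂ) + t * Complex.I) ^ 2)⁻¹).re =
      2 * (cos (c * |t|) * ((x ^ 2 - |t| ^ 2) / (x ^ 2 + |t| ^ 2) ^ 2)) := fun t => by
    have hcos : cos (c * |t|) = cos (t * c) := by
      rw [← cos_abs (t * c), abs_mul, abs_of_pos hc, mul_comm]
    have hI : ((x : ℂ) + t * Complex.I) ^ 2 =
        ((x ^ 2 - t ^ 2 : ℝ) : ℂ) + (2 * x * t : ℝ) * Complex.I := by
      push_cast
      linear_combination (t : ℂ) ^ 2 * Complex.I_sq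
    have hE : Complex.exp ((t * c : ℝ) * Complex.I) + Complex.exp ((t * -c : ℝ) * Complex.I) =
        ((2 * cos (t * c) : ℝ) : ℂ) := by
      push_cast
      rw [Complex.two_cos]
      simp
    rw [← add_mul, hE, Complex.re_ofReal_mul, Complex.inv_re, hI, Complex.normSq_add_mul_I, hcos,
      sq_abs]
    simp only [Complex.add_re, Complex.ofReal_re, Complex.re_ofReal_mul, Complex.I_re, mul_zero,
      add_zero]
    rw [show (x ^ 2 - t ^ 2) ^ 2 + (2 * x * t) ^ 2 = (x ^ 2 + t ^ 2) ^ 2 by ring]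
    ring
  simp only [hpt] at hre
  rw [MeasureTheory.integral_const_mul, integral_comp_abs
    (f := fun t => cos (c * t) * ((x ^ 2 - t ^ 2) / (x ^ 2 + t ^ 2) ^ 2))] at hre
  simp only [zero_mul, mul_zero, Complex.ofReal_zero, add_zero, Complex.ofReal_re] at hre
  rw [show -c * x = -x * c by ring]
  linarith

lemma intervalIntegrable_mul_sin_div {x : ℝ} (hx : 0 < x) (c p q : ℝ) :
    IntervalIntegrable (fun t : ℝ => t * sin (c * t) / (x ^ 2 + t ^ 2)) volume p q := by
  have : ∀ t : ℝ, x ^ 2 + t ^ 2 ≠ 0 := fun t => by positivity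
  exact Continuous.intervalIntegrable (by fun_prop (disch := assumption)) _ _

/-- The Laplace integral of `t sin (c t) / (x² + t²)` over the half-line. -/
lemma tendsto_integral_mul_sin_div {x c : ℝ} (hx : 0 < x) (hc : 0 < c) :
    Tendsto (fun R : ℝ => ∫ t in (0 : ℝ)..R, t * sin (c * t) / (x ^ 2 + t ^ 2))
      atTop (nhds (π / 2 * rexp (-c * x))) := by
  have hne : ∀ t : ℝ, x ^ 2 + t ^ 2 ≠ 0 := fun t => by positivity
  have hparts : ∀ R : ℝ, ∫ t in (0 : ℝ)..R, t * sin (c * t) / (x ^ 2 + t ^ 2) =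
      -(c⁻¹ * (R / (x ^ 2 + R ^ 2) * cos (c * R))) + c⁻¹ *
        ∫ t in (0 : ℝ)..R, cos (c * t) * ((x ^ 2 - t ^ 2) / (x ^ 2 + t ^ 2) ^ 2) := fun R => by
    have hu : ∀ t ∈ Set.uIcc 0 R, HasDerivAt (fun t : ℝ => t / (x ^ 2 + t ^ 2))
        ((x ^ 2 - t ^ 2) / (x ^ 2 + t ^ 2) ^ 2) t := fun t _ => by
      refine ((hasDerivAt_id' t).fun_div (((hasDerivAt_id' t).fun_pow 2).const_add (x ^ 2))
        (hne t)).congr_deriv ?_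
      ring
    have hv : ∀ t ∈ Set.uIcc 0 R, HasDerivAt (fun t : ℝ => -c⁻¹ * cos (c * t)) (sin (c * t)) t :=
      fun t _ => by
        refine ((((hasDerivAt_id' t).const_mul c).cos).const_mul (-c⁻¹)).congr_deriv ?_
        simp only [mul_one, neg_mul, mul_neg, neg_neg]
        rw [mul_left_comm, inv_mul_cancel₀ hc.ne', mul_one]
    have hne2 : ∀ t : ℝ, (x ^ 2 + t ^ 2) ^ 2 ≠ 0 := fun t => pow_ne_zero 2 (hne t)
    have := intervalIntegral.integral_mul_deriv_eq_deriv_mul hu hv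
      (Continuous.intervalIntegrable (by fun_prop (disch := assumption)) _ _)
      (Continuous.intervalIntegrable (by fun_prop) _ _)
    simp only [zero_div, zero_mul, sub_zero] at this
    rw [← intervalIntegral.integral_const_mul]
    calc _ = ∫ t in (0 : ℝ)..R, t / (x ^ 2 + t ^ 2) * sin (c * t) := by
          congr 1; ext t; ring
      _ = _ := this
      _ = _ := by
        rw [sub_eq_add_neg, ← intervalIntegral.integral_neg]
        congr 1
        · ring
        · congr 1; ext t; ring
  simp only [hparts]
  have hlim := intervalIntegral_tendsto_integral_Ioi 0
    (integrable_cos_mul_sq_sub_sq_div hx c).integrableOn tendsto_id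
  rw [integral_Ioi_cos_mul_sq_sub_sq_div hx hc] at hlim
  have hbd : Tendsto (fun R : ℝ => R / (x ^ 2 + R ^ 2) * cos (c * R)) atTop (nhds 0) := by
    refine squeeze_zero_norm' ?_ tendsto_inv_atTop_zero
    filter_upwards [eventually_gt_atTop 0] with R hR
    have hp : 0 < x ^ 2 + R ^ 2 := by positivity
    rw [norm_mul, norm_div, Real.norm_of_nonneg hR.le, Real.norm_of_nonneg hp.le]
    calc _ ≤ R / (x ^ 2 + R ^ 2) * 1 := by
          gcongr
          exact abs_cos_le_one _
      _ ≤ R⁻¹ := by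
          rw [mul_one, div_le_iff₀ hp, inv_mul_eq_div, le_div_iff₀ hR]
          nlinarith [sq_nonneg x]
  convert ((hbd.const_mul c⁻¹).neg).add (hlim.const_mul c⁻¹) using 2
  · rfl
  · rw [mul_zero, neg_zero, zero_add]
    field_simp

theorem t_sin_cos_integral (a b x : ℝ) (hx : 0 < x) (ha : 0 < a) (hab : a < b) :
    Tendsto (fun R : ℝ =>
        ∫ t in (0:ℝ)..R, t * Real.sin (b * t) * Real.cos (a * t) / (x ^ 2 + t ^ 2))
      atTop (nhds ((Real.pi / 2) * Real.exp (-b * x) * Real.cosh (a * x))) := by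
  have h := ((tendsto_integral_mul_sin_div hx (add_pos (ha.trans hab) ha)).add
    (tendsto_integral_mul_sin_div hx (sub_pos.2 hab))).const_mul (1 / 2)
  convert h using 2 with R
  · rw [← intervalIntegral.integral_add (intervalIntegrable_mul_sin_div hx _ _ _)
      (intervalIntegrable_mul_sin_div hx _ _ _), ← intervalIntegral.integral_const_mul]
    congr 1
    ext t
    rw [add_mul, sub_mul, sin_add, sin_sub]
    ring
  · rw [cosh_eq, show -(b + a) * x = -b * x + -(a * x) by ring,
      show -(b - a) * x = -b * x + a * x by ring, exp_add, exp_add]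
    ring
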